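/- In Cl(4,2), set E = ι(e₂)ι(e₅), g = ι(e₂)ι(e₃) + ι(e₂)ι(e₆), f = ι(e₃)ι(e₅) − ι(e₅)ι(e₆). For s, φ ∈ ℝ let T = 2 + s sin φ · g + s cos φ · f and T' = 2 − s sin φ · g − s cos φ · f. Then T · T' = 4, and for every point representation 𝔭 = 2E + x₀ f + y₀ g: T · 𝔭 · T' = 4·(2E + (x₀ − 2s sin φ) f + (y₀ + 2s cos φ) g); i.e. the sandwich action of T is the translation by the vector 2s(−sin φ, cos φ) normal to the reflecting lines. -/

import Mathlib

/-- The bilinear form on `ℝ⁶` whose matrix has entries `B₂₂ = B₅₅ = 1`,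
`B₁₃ = B₃₁ = B₄₆ = B₆₄ = −1` (indices 0-based here). -/
noncomputable def B6 : LinearMap.BilinMap ℝ (Fin 6 → ℝ) ℝ :=
  LinearMap.mk₂ ℝ
    (fun u w => u 1 * w 1 + u 4 * w 4 - u 0 * w 2 - u 2 * w 0 - u 3 * w 5 - u 5 * w 3)
    (by intros; simp only [Pi.add_apply]; ring)
    (by intros; simp only [Pi.smul_apply, smul_eq_mul]; ring)
    (by intros; simp only [Pi.add_apply]; ring)
    (by intros; simp only [Pi.smul_apply, smul_eq_mul]; ring)

/-- The quadratic form `Q(v) = v₂² + v₅² − 2v₁v₃ − 2v₄v₆` on `ℝ⁶`, of signature `(4,2)`. -/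
noncomputable def Q6 : QuadraticForm ℝ (Fin 6 → ℝ) := B6.toQuadraticMap

/-- The standard basis of `ℝ⁶`; `e i` corresponds to `e_{i+1}` in the paper. -/
noncomputable def e (i : Fin 6) : Fin 6 → ℝ := Pi.single i 1

open CliffordAlgebra

/-- `E = e₂e₅`. -/
noncomputable def E : CliffordAlgebra Q6 := ι Q6 (e 1) * ι Q6 (e 4)

/-- `g = e₂e₃ + e₂e₆`, corresponding to `e_{23} + e_{26}` in the paper. -/
noncomputable def g : CliffordAlgebra Q6 := ι Q6 (e 1) * ι Q6 (e 2) + ι Q6 (e 1) * ι Q6 (e 5)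

/-- `f = e₃e₅ − e₅e₆`, corresponding to `e_{35} − e_{56}` in the paper. -/
noncomputable def f : CliffordAlgebra Q6 := ι Q6 (e 2) * ι Q6 (e 4) - ι Q6 (e 4) * ι Q6 (e 5)

/-- The translation element `T = 2 + s sin φ · g + s cos φ · f`. -/
noncomputable def T (s φ : ℝ) : CliffordAlgebra Q6 :=
  2 + (s * Real.sin φ) • g + (s * Real.cos φ) • f

/-- The reversed translation element `T' = 2 − s sin φ · g − s cos φ · f`. -/
noncomputable def T' (s φ : ℝ) : CliffordAlgebra Q6 :=
  2 - (s * Real.sin φ) • g - (s * Real.cos φ) • f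

/-- The null vector `e₃ + e₆`, from which `f` and `g` are built. -/
noncomputable def nullVec : CliffordAlgebra Q6 := ι Q6 (e 2 + e 5)

lemma Q6_apply (v : Fin 6 → ℝ) :
    Q6 v = v 1 ^ 2 + v 4 ^ 2 - 2 * v 0 * v 2 - 2 * v 3 * v 5 := by
  simp only [Q6, B6, LinearMap.BilinMap.toQuadraticMap_apply, LinearMap.mk₂_apply]
  ring

lemma polar_Q6 (u w : Fin 6 → ℝ) :
    QuadraticMap.polar Q6 u w =
      2 * (u 1 * w 1 + u 4 * w 4 - u 0 * w 2 - u 2 * w 0 - u 3 * w 5 - u 5 * w 3) := by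
  simp only [QuadraticMap.polar, Q6_apply, Pi.add_apply]
  ring

lemma ι_mul_ι_anticomm {u w : Fin 6 → ℝ} (h : QuadraticMap.polar Q6 u w = 0) :
    ι Q6 u * ι Q6 w = -(ι Q6 w * ι Q6 u) := by
  rw [eq_neg_iff_add_eq_zero, ι_mul_ι_add_swap, h, map_zero]

lemma ι_e_one_sq : ι Q6 (e 1) * ι Q6 (e 1) = 1 := by
  simp [ι_sq_scalar, Q6_apply, e]

lemma ι_e_four_sq : ι Q6 (e 4) * ι Q6 (e 4) = 1 := by
  simp [ι_sq_scalar, Q6_apply, e]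

lemma nullVec_sq : nullVec * nullVec = 0 := by
  simp [nullVec, ι_sq_scalar, Q6_apply, e, -map_add]

lemma ι_e_four_mul_ι_e_one : ι Q6 (e 4) * ι Q6 (e 1) = -(ι Q6 (e 1) * ι Q6 (e 4)) :=
  ι_mul_ι_anticomm (by simp [polar_Q6, e])

lemma nullVec_mul_ι_e_one : nullVec * ι Q6 (e 1) = -(ι Q6 (e 1) * nullVec) :=
  ι_mul_ι_anticomm (by simp [polar_Q6, e])

lemma nullVec_mul_ι_e_four : nullVec * ι Q6 (e 4) = -(ι Q6 (e 4) * nullVec) :=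
  ι_mul_ι_anticomm (by simp [polar_Q6, e])

lemma g_eq : g = ι Q6 (e 1) * nullVec := by
  simp [g, nullVec, mul_add]

lemma f_eq : f = -(ι Q6 (e 4) * nullVec) := by
  have h : ι Q6 (e 2) * ι Q6 (e 4) = -(ι Q6 (e 4) * ι Q6 (e 2)) :=
    ι_mul_ι_anticomm (by simp [polar_Q6, e])
  rw [f, nullVec, h, map_add, mul_add]
  abel

/-- Elements of the form `a * n` and `b * n` multiply to zero when `n` squares to zero and
anticommutes with `b`. -/
lemma mul_mul_mul_eq_zero_of_anticomm {R : Type*} [Ring R] {n b : R} (hn : n * n = 0)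
    (h : n * b = -(b * n)) (a : R) : a * n * (b * n) = 0 := by
  rw [mul_assoc, ← mul_assoc n, h, neg_mul, mul_assoc b, hn, mul_zero, neg_zero, mul_zero]

lemma g_mul_g : g * g = 0 := by
  rw [g_eq]
  exact mul_mul_mul_eq_zero_of_anticomm nullVec_sq nullVec_mul_ι_e_one _

lemma f_mul_f : f * f = 0 := by
  rw [f_eq, neg_mul_neg]
  exact mul_mul_mul_eq_zero_of_anticomm nullVec_sq nullVec_mul_ι_e_four _

lemma g_mul_f : g * f = 0 := by
  rw [g_eq, f_eq, mul_neg, neg_eq_zero]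
  exact mul_mul_mul_eq_zero_of_anticomm nullVec_sq nullVec_mul_ι_e_four _

lemma f_mul_g : f * g = 0 := by
  rw [g_eq, f_eq, neg_mul, neg_eq_zero]
  exact mul_mul_mul_eq_zero_of_anticomm nullVec_sq nullVec_mul_ι_e_one _

lemma E_mul_g : E * g = f := by
  rw [E, g_eq, f_eq, mul_assoc, ← mul_assoc (ι Q6 (e 4)), ι_e_four_mul_ι_e_one, neg_mul, mul_neg,
    ← mul_assoc, ← mul_assoc, ι_e_one_sq, one_mul]

lemma E_mul_f : E * f = -g := by
  rw [E, g_eq, f_eq, mul_neg, mul_assoc, ← mul_assoc (ι Q6 (e 4)), ι_e_four_sq, one_mul]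

lemma g_mul_E : g * E = -f := by
  rw [E, g_eq, f_eq, mul_assoc, ← mul_assoc nullVec, nullVec_mul_ι_e_one, neg_mul, mul_neg,
    ← mul_assoc, ← mul_assoc, ι_e_one_sq, one_mul, nullVec_mul_ι_e_four]

lemma f_mul_E : f * E = g := by
  rw [E, g_eq, f_eq, neg_mul, mul_assoc, ← mul_assoc nullVec, nullVec_mul_ι_e_one, neg_mul,
    mul_neg, neg_neg, mul_assoc, nullVec_mul_ι_e_four, mul_neg, mul_neg, ← mul_assoc (ι Q6 (e 1)),
    ← mul_assoc, ← mul_assoc, ι_e_four_mul_ι_e_one, neg_mul, neg_mul, neg_neg,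
    mul_assoc (ι Q6 (e 1)), ι_e_four_sq, mul_one]

/-- `T·T' = 4`, and the sandwich action of `T` on the point
representation `𝔭 = 2E + x₀f + y₀g` is the translation by `2s(−sin φ, cos φ)`. -/
theorem translation_sandwich (s φ : ℝ) :
    T s φ * T' s φ = 4 ∧
      ∀ x₀ y₀ : ℝ,
        T s φ * ((2 : ℝ) • E + x₀ • f + y₀ • g) * T' s φ =
          (4 : ℝ) • ((2 : ℝ) • E + (x₀ - 2 * s * Real.sin φ) • f +
            (y₀ + 2 * s * Real.cos φ) • g) := by
  have two_eq : (2 : CliffordAlgebra Q6) = (2 : ℝ) • 1 := by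
    rw [← Algebra.algebraMap_eq_smul_one, map_ofNat]
  have four_eq : (4 : CliffordAlgebra Q6) = (4 : ℝ) • 1 := by
    rw [← Algebra.algebraMap_eq_smul_one, map_ofNat]
  constructor
  · simp only [T, T', two_eq, four_eq, add_mul, mul_sub, smul_mul_assoc,
      mul_smul_comm, one_mul, mul_one, g_mul_g, f_mul_f, g_mul_f, f_mul_g]
    module
  · intro x₀ y₀
    simp only [T, T', two_eq, mul_add, add_mul, mul_sub, smul_mul_assoc, mul_smul_comm,
      one_mul, mul_one, zero_mul, neg_mul, smul_zero, g_mul_g, f_mul_f, g_mul_f, f_mul_g,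
      E_mul_g, E_mul_f, g_mul_E, f_mul_E]
    module
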